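/- arXiv:1809.10251 — 4 statements merged into one kernel-verified Lean document; each statement's English description precedes it below -/
import Mathlib

section
/- Let (θ_ν)_{ν∈ℱ} be a family of positive real numbers that is monotonically decreasing (i.e. μ ≼ ν implies θ_ν ≤ θ_μ) and satisfies ∑_{ν∈ℱ} θ_ν^s < ∞ for some s ∈ (0,1). Then there exists a sequence (Λ_N)_{N≥1} of subsets of ℱ that is nested (Λ_N ⊆ Λ_{N+1}), with each Λ_N downward closed and of cardinality N, such that ∑_{ν∈ℱ∖Λ_N} θ_ν ≤ (∑_{ν∈ℱ} θ_ν^s)^{1/s} N^{−(1/s − 1)} for every N ≥ 1. -/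
open MeasureTheory Filter Topology

/-- A finite set of indices that is downward closed and carries the largest values of `f`. -/
def IsGreedyLowerSet {ι : Type*} [Preorder ι] (f : ι → ℝ) (A : Finset ι) : Prop :=
  IsLowerSet (A : Set ι) ∧ ∀ μ ∈ A, ∀ ν ∉ A, f ν ≤ f μ

open scoped Classical in
/-- For an antitone `f` with finite superlevel sets, a greedy lower set can be enlarged by one
element. -/
theorem IsGreedyLowerSet.exists_insert {ι : Type*} [PartialOrder ι] [Infinite ι] {f : ι → ℝ}
    (hf : Antitone f) (hfin : ∀ ν, {μ | f ν ≤ f μ}.Finite) {A : Finset ι}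
    (hA : IsGreedyLowerSet f A) : ∃ ν ∉ A, IsGreedyLowerSet f (insert ν A) := by
  obtain ⟨ν₀, hν₀⟩ := Infinite.exists_notMem_finset A
  obtain ⟨m, ⟨hmA, hm₀⟩, hm⟩ := Set.exists_max_image {μ | μ ∉ A ∧ f ν₀ ≤ f μ} f
    ((hfin ν₀).subset fun μ hμ => hμ.2) ⟨ν₀, hν₀, le_rfl⟩
  have hmax : ∀ μ ∉ A, f μ ≤ f m := fun μ hμ =>
    (le_total (f ν₀) (f μ)).elim (fun h => hm μ ⟨hμ, h⟩) fun h => h.trans hm₀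
  obtain ⟨ν, ⟨hνA, hνm⟩, hν⟩ := Set.Finite.exists_minimal (s := {μ | μ ∉ A ∧ f m ≤ f μ})
    ((hfin m).subset fun μ hμ => hμ.2) ⟨m, hmA, le_rfl⟩
  refine ⟨ν, hνA, ?_, ?_⟩
  · intro a b hba ha
    simp only [Finset.coe_insert, Set.mem_insert_iff, Finset.mem_coe] at ha ⊢
    by_cases hb : b ∈ A
    · exact Or.inr hb
    rcases ha with rfl | ha
    · exact Or.inl (le_antisymm hba (hν ⟨hb, hνm.trans (hf hba)⟩ hba))
    · exact Or.inr (hA.1 hba ha)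
  · intro μ hμ κ hκ
    rw [Finset.mem_insert, not_or] at hκ
    rcases Finset.mem_insert.1 hμ with rfl | hμ
    · exact (hmax κ hκ.2).trans hνm
    · exact hA.2 μ hμ κ hκ.2

/-- There is a nested sequence of greedy lower sets, one of each cardinality. -/
theorem exists_nested_isGreedyLowerSet {ι : Type*} [PartialOrder ι] [Infinite ι] {f : ι → ℝ}
    (hf : Antitone f) (hfin : ∀ ν, {μ | f ν ≤ f μ}.Finite) :
    ∃ A : ℕ → Finset ι, ∀ N, (A N).card = N ∧ IsGreedyLowerSet f (A N) ∧ A N ⊆ A (N + 1) := by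
  classical
  choose next hnext hins using
    fun A : {A : Finset ι // IsGreedyLowerSet f A} => A.2.exists_insert hf hfin
  let A : ℕ → {A : Finset ι // IsGreedyLowerSet f A} := fun N =>
    Nat.rec ⟨∅, by simp [IsGreedyLowerSet, isLowerSet_empty]⟩ (fun _ B => ⟨insert (next B) B.1, hins B⟩) N
  have hsucc : ∀ N, (A (N + 1)).1 = insert (next (A N)) (A N).1 := fun _ => rfl
  refine ⟨fun N => (A N).1, fun N => ⟨?_, (A N).2, ?_⟩⟩
  · induction N with
    | zero => rfl
    | succ N ih => simp only [hsucc, Finset.card_insert_of_notMem (hnext (A N)), ih]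
  · simp only [hsucc]
    exact Finset.subset_insert _ _

/-- Superlevel sets of a positive family with summable `s`-th powers are finite. -/
theorem finite_superlevel_of_summable_rpow {ι : Type*} {f : ι → ℝ} (hpos : ∀ ν, 0 < f ν) {s : ℝ}
    (hs : 0 < s) (hsum : Summable fun ν => f ν ^ s) (ν : ι) : {μ | f ν ≤ f μ}.Finite := by
  have h := hsum.tendsto_cofinite_zero.eventually_lt_const (Real.rpow_pos_of_pos (hpos ν) s)
  refine (Filter.eventually_cofinite.1 h).subset fun μ hμ => ?_
  exact not_lt.2 (Real.rpow_le_rpow (hpos ν).le hμ hs.le)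

/-- Stechkin's inequality: the tail of a positive family beyond a set of `N` largest values. -/
theorem tsum_notMem_le_of_summable_rpow {ι : Type*} {f : ι → ℝ} (hpos : ∀ ν, 0 < f ν) {s : ℝ}
    (hs0 : 0 < s) (hs1 : s < 1) (hsum : Summable fun ν => f ν ^ s) {A : Finset ι}
    (hA : A.Nonempty) (hbest : ∀ μ ∈ A, ∀ ν ∉ A, f ν ≤ f μ) :
    ∑' ν : {ν // ν ∉ A}, f ν.1 ≤
      (∑' ν, f ν ^ s) ^ (1 / s) * (A.card : ℝ) ^ (-(1 / s - 1)) := by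
  set S := ∑' ν, f ν ^ s
  have hN : (0 : ℝ) < A.card := by exact_mod_cast hA.card_pos
  have hp : ∀ ν, 0 < f ν ^ s := fun ν => Real.rpow_pos_of_pos (hpos ν) s
  have hS : 0 < S := by
    obtain ⟨ν, -⟩ := hA
    exact hsum.tsum_pos (fun μ => (hp μ).le) ν (hp ν)
  have hexp : 0 < 1 / s - 1 := by
    have := (lt_div_iff₀ hs0).2 (by linarith : 1 * s < 1)
    linarith
  have hpt : ∀ ν ∉ A, f ν ≤ f ν ^ s * (S / A.card) ^ (1 / s - 1) := by
    intro ν hν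
    have h1 : f ν ^ s ≤ S / A.card := by
      rw [le_div_iff₀ hN, mul_comm, ← nsmul_eq_mul]
      exact (Finset.card_nsmul_le_sum A _ _ fun μ hμ =>
        Real.rpow_le_rpow (hpos ν).le (hbest μ hμ ν hν) hs0.le).trans
          (hsum.sum_le_tsum A fun μ _ => (hp μ).le)
    calc f ν = f ν ^ s * (f ν ^ s) ^ (1 / s - 1) := by
          rw [← Real.rpow_mul (hpos ν).le, ← Real.rpow_add (hpos ν)]
          have : s + s * (1 / s - 1) = 1 := by field_simp; ring
          rw [this, Real.rpow_one]
      _ ≤ _ := by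
          gcongr
          all_goals exact (hp ν).le
  have hsub : Summable fun ν : {ν // ν ∉ A} => f ν.1 ^ s := hsum.subtype {ν | ν ∉ A}
  have hsub' := hsub.mul_right ((S / A.card) ^ (1 / s - 1))
  have hf : Summable fun ν : {ν // ν ∉ A} => f ν.1 :=
    hsub'.of_nonneg_of_le (fun ν => (hpos ν).le) fun ν => hpt ν ν.2
  calc ∑' ν : {ν // ν ∉ A}, f ν.1
      ≤ ∑' ν : {ν // ν ∉ A}, f ν.1 ^ s * (S / A.card) ^ (1 / s - 1) :=
        hf.tsum_le_tsum (fun ν => hpt ν ν.2) hsub'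
    _ = (∑' ν : {ν // ν ∉ A}, f ν.1 ^ s) * (S / A.card) ^ (1 / s - 1) := tsum_mul_right
    _ ≤ S * (S / A.card) ^ (1 / s - 1) := by
        gcongr
        exact hsum.tsum_subtype_le _ {ν | ν ∉ A} fun ν => (hp ν).le
    _ = S ^ (1 / s) * (A.card : ℝ) ^ (-(1 / s - 1)) := by
        rw [Real.div_rpow hS.le hN.le, Real.rpow_neg hN.le, Real.rpow_sub_one hS.ne']
        field_simp

theorem stmt11 (θf : (ℕ →₀ ℕ) → ℝ) (hpos : ∀ ν, 0 < θf ν)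
  (hmono : ∀ μ ν : ℕ →₀ ℕ, μ ≤ ν → θf ν ≤ θf μ)
  (s : ℝ) (hs0 : 0 < s) (hs1 : s < 1)
  (hsum : Summable fun ν => θf ν ^ s) :
  ∃ Λ : ℕ → Finset (ℕ →₀ ℕ),
    (∀ N : ℕ, 1 ≤ N → (Λ N).card = N) ∧
    (∀ N : ℕ, 1 ≤ N → ∀ ν ∈ Λ N, ∀ σ : ℕ →₀ ℕ, σ ≤ ν → σ ∈ Λ N) ∧
    (∀ N : ℕ, 1 ≤ N → Λ N ⊆ Λ (N + 1)) ∧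
    (∀ N : ℕ, 1 ≤ N →
      ∑' ν : {ν : ℕ →₀ ℕ // ν ∉ Λ N}, θf ν.1 ≤
        (∑' ν : ℕ →₀ ℕ, θf ν ^ s) ^ (1 / s) * (N : ℝ) ^ (-(1 / s - 1))) := by
  obtain ⟨Λ, hΛ⟩ := exists_nested_isGreedyLowerSet (f := θf) (fun μ ν h => hmono μ ν h)
    (finite_superlevel_of_summable_rpow hpos hs0 hsum)
  refine ⟨Λ, fun N _ => (hΛ N).1, fun N _ ν hν σ hσ => (hΛ N).2.1.1 hσ hν,
    fun N _ => (hΛ N).2.2, fun N hN => ?_⟩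
  have hne : (Λ N).Nonempty := Finset.card_pos.1 (by rw [(hΛ N).1]; exact hN)
  have h := tsum_notMem_le_of_summable_rpow hpos hs0 hs1 hsum hne (hΛ N).2.1.2
  rwa [(hΛ N).1] at h
end

section
/- Let t ∈ (0,∞) and let ρ = (ρ_j)_{j≥1} satisfy ρ_j > 1 for all j and ∑_{j≥1} ρ_j^{−t} < ∞. Then ∑_{ν∈ℱ} ∏_{j≥1} ρ_j^{−tν_j} (1 + ν_j)^t < ∞. -/
open MeasureTheory Filter Topology

theorem summable_finsupp_prod_of_nonneg {ι : Type*} {f : ι → ℕ → ℝ} (hf : ∀ j k, 0 ≤ f j k)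
    (hf0 : ∀ j, f j 0 = 1) (hs : ∀ j, Summable (f j))
    (ht : Summable fun j => ∑' k, f j (k + 1)) :
    Summable fun ν : ι →₀ ℕ => ν.prod f := by
  classical
  refine summable_of_sum_le (c := Real.exp (∑' j, ∑' k, f j (k + 1)))
    (fun ν => Finset.prod_nonneg fun j _ => hf j _) fun S => ?_
  let T : Finset ι := S.biUnion Finsupp.support
  let R : ι → Finset ℕ := fun j => S.image fun ν => ν j
  have hT : ∀ ν ∈ S, ν.support ⊆ T := fun ν hν => Finset.subset_biUnion_of_mem _ hν
  let e : (ι →₀ ℕ) → (j : ι) → j ∈ T → ℕ := fun ν j _ => ν j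
  have hinj : Set.InjOn e S := by
    intro ν hν μ hμ h
    ext j
    by_cases hj : j ∈ T
    · exact congrFun (congrFun h j) hj
    · rw [Finsupp.notMem_support_iff.mp fun h' => hj (hT ν hν h'),
        Finsupp.notMem_support_iff.mp fun h' => hj (hT μ hμ h')]
  calc ∑ ν ∈ S, ν.prod f
      = ∑ ν ∈ S, ∏ x ∈ T.attach, f x.1 (e ν x.1 x.2) := by
        refine Finset.sum_congr rfl fun ν hν => ?_
        rw [Finsupp.prod_of_support_subset ν (hT ν hν) f fun j _ => hf0 j, ← Finset.prod_attach]
    _ = ∑ p ∈ S.image e, ∏ x ∈ T.attach, f x.1 (p x.1 x.2) :=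
        (Finset.sum_image (f := fun p : (j : ι) → j ∈ T → ℕ =>
          ∏ x ∈ T.attach, f x.1 (p x.1 x.2)) hinj).symm
    _ ≤ ∑ p ∈ T.pi R, ∏ x ∈ T.attach, f x.1 (p x.1 x.2) := by
        refine Finset.sum_le_sum_of_subset_of_nonneg ?_
          fun p _ _ => Finset.prod_nonneg fun x _ => hf _ _
        intro p hp
        obtain ⟨ν, hν, rfl⟩ := Finset.mem_image.mp hp
        exact Finset.mem_pi.mpr fun j _ => Finset.mem_image_of_mem _ hν
    _ = ∏ j ∈ T, ∑ k ∈ R j, f j k := (Finset.prod_sum T R f).symm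
    _ ≤ ∏ j ∈ T, Real.exp (∑' k, f j (k + 1)) := by
        refine Finset.prod_le_prod (fun j _ => Finset.sum_nonneg fun k _ => hf j k) fun j _ => ?_
        calc ∑ k ∈ R j, f j k ≤ ∑' k, f j k := (hs j).sum_le_tsum _ fun k _ => hf j k
          _ = ∑' k, f j (k + 1) + 1 := by rw [(hs j).tsum_eq_zero_add, hf0, add_comm]
          _ ≤ _ := Real.add_one_le_exp _
    _ = Real.exp (∑ j ∈ T, ∑' k, f j (k + 1)) := (Real.exp_sum _ _).symm
    _ ≤ _ := Real.exp_le_exp.mpr (ht.sum_le_tsum _ fun j _ => tsum_nonneg fun k => hf j _)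

theorem summable_geometric_mul_one_add_rpow (t : ℝ) {x : ℝ} (hx0 : 0 < x) (hx1 : x < 1) :
    Summable fun k : ℕ => x ^ k * (1 + (k : ℝ)) ^ t := by
  obtain ⟨n, hn⟩ := exists_nat_ge t
  have h := (summable_nat_add_iff 1).mpr
    (summable_pow_mul_geometric_of_norm_lt_one n (r := x) (by rwa [Real.norm_of_nonneg hx0.le]))
  refine Summable.of_nonneg_of_le (fun k => by positivity) (fun k => ?_) (h.mul_left x⁻¹)
  calc x ^ k * (1 + (k : ℝ)) ^ t ≤ x ^ k * (1 + (k : ℝ)) ^ (n : ℝ) := by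
        gcongr
        linarith [k.cast_nonneg (α := ℝ)]
    _ = _ := by
        rw [Real.rpow_natCast]
        push_cast
        field_simp
        ring

theorem stmt15 (t : ℝ) (ht : 0 < t) (ρ : ℕ → ℝ) (hρ : ∀ j, 1 < ρ j)
  (hsum : Summable fun j => (ρ j)⁻¹ ^ t) :
  Summable fun ν : ℕ →₀ ℕ =>
    ν.prod fun j k => ρ j ^ (-(t * (k : ℝ))) * (1 + (k : ℝ)) ^ t := by
  have hρ0 : ∀ j, 0 < ρ j := fun j => one_pos.trans (hρ j)
  have hx0 : ∀ j, 0 < (ρ j)⁻¹ ^ t := fun j => Real.rpow_pos_of_pos (inv_pos.mpr (hρ0 j)) t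
  have hx1 : ∀ j, (ρ j)⁻¹ ^ t < 1 := fun j =>
    Real.rpow_lt_one (inv_pos.mpr (hρ0 j)).le (inv_lt_one_of_one_lt₀ (hρ j)) ht
  have hpow : ∀ j (k : ℕ), ρ j ^ (-(t * (k : ℝ))) = ((ρ j)⁻¹ ^ t) ^ k := fun j k => by
    rw [Real.rpow_neg (hρ0 j).le, ← Real.inv_rpow (hρ0 j).le,
      Real.rpow_mul (inv_pos.mpr (hρ0 j)).le, Real.rpow_natCast]
  simp only [hpow]
  generalize hx : (fun j => (ρ j)⁻¹ ^ t) = x at hsum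
  simp only [funext_iff] at hx
  simp only [hx] at hx0 hx1 ⊢
  have hs := fun j => summable_geometric_mul_one_add_rpow t (hx0 j) (hx1 j)
  have hhalf := (summable_nat_add_iff 1).mpr
    (summable_geometric_mul_one_add_rpow t (x := 1 / 2) (by norm_num) (by norm_num))
  refine summable_finsupp_prod_of_nonneg (f := fun j k => x j ^ k * (1 + (k : ℝ)) ^ t)
    (fun j k => mul_nonneg (pow_nonneg (hx0 j).le k) (by positivity)) (fun j => by simp) hs ?_
  refine Summable.of_norm_bounded_eventually_nat
    (hsum.mul_right (2 * ∑' k : ℕ, (1 / 2 : ℝ) ^ (k + 1) * (1 + ((k + 1 : ℕ) : ℝ)) ^ t)) ?_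
  filter_upwards [hsum.tendsto_atTop_zero.eventually_le_const (by norm_num : (0 : ℝ) < 1 / 2)]
    with j hj
  have hxj := hx0 j
  rw [Real.norm_of_nonneg (tsum_nonneg fun k => by positivity), ← mul_assoc, ← tsum_mul_left]
  refine ((summable_nat_add_iff 1).mpr (hs j)).tsum_le_tsum (fun k => ?_) (hhalf.mul_left _)
  rw [← mul_assoc]
  gcongr
  calc x j ^ (k + 1) = x j * x j ^ k := pow_succ' _ _
    _ ≤ x j * (1 / 2) ^ k := by gcongr
    _ = x j * 2 * (1 / 2) ^ (k + 1) := by ring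
end

section
/- Let t ∈ (0,∞), set s := 2t/(2+t), let ρ = (ρ_j)_{j≥1} satisfy ρ_j > 1 for all j and ∑_{j≥1} ρ_j^{−t} < ∞, and let (a_ν)_{ν∈ℱ} be nonnegative real numbers with ∑_{ν∈ℱ} (ρ^{ν} a_ν)² < ∞. Then ∑_{ν∈ℱ} a_ν^s < ∞; more precisely, ∑_{ν∈ℱ} a_ν^s ≤ (∑_{ν∈ℱ} (ρ^{ν} a_ν)²)^{s/2} (∑_{ν∈ℱ} ρ^{−tν})^{(2−s)/2}. -/
open MeasureTheory Filter Topology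

/-- The generating function of a box of multi-indices factorizes. -/
theorem Finset.sum_finsupp_prod_pow {ι R : Type*} [CommSemiring R] (s : Finset ι)
    (t : ι → Finset ℕ) (x : ι → R) :
    ∑ ν ∈ s.finsupp t, (ν.prod fun j k => x j ^ k) = ∏ j ∈ s, ∑ k ∈ t j, x j ^ k := by
  classical
  rw [Finset.prod_sum, Finset.finsupp, Finset.sum_map]
  refine Finset.sum_congr rfl fun p _ => ?_
  rw [Function.Embedding.coeFn_mk,
    Finsupp.prod_of_support_subset _ (Finsupp.support_indicator_subset s p) _ (by simp),
    ← Finset.prod_attach]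
  refine Finset.prod_congr rfl fun j _ => ?_
  simp [Finsupp.indicator_of_mem j.2]

theorem Finsupp.summable_prod_pow {ι : Type*} {x : ι → ℝ} (hx0 : ∀ j, 0 ≤ x j)
    (hx1 : ∀ j, x j < 1) (hx : Summable x) :
    Summable fun ν : ι →₀ ℕ => ν.prod fun j k => x j ^ k := by
  classical
  have hpos : ∀ j, 0 < 1 - x j := fun j => sub_pos.2 (hx1 j)
  have hquot : Summable fun j => x j / (1 - x j) := by
    refine Summable.of_norm_bounded_eventually (hx.mul_left 2) ?_
    filter_upwards [hx.tendsto_cofinite_zero.eventually_lt_const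
      (show (0 : ℝ) < 1 / 2 by norm_num)] with j hj
    rw [Real.norm_of_nonneg (div_nonneg (hx0 j) (hpos j).le), div_le_iff₀ (hpos j)]
    nlinarith [hx0 j]
  have hnonneg : ∀ ν : ι →₀ ℕ, 0 ≤ ν.prod fun j k => x j ^ k :=
    fun ν => Finset.prod_nonneg fun j _ => pow_nonneg (hx0 j) _
  refine summable_of_sum_le (c := Real.exp (∑' j, x j / (1 - x j))) hnonneg fun S => ?_
  let s : Finset ι := S.biUnion Finsupp.support
  let t : ι → Finset ℕ := fun j => S.image fun ν => ν j
  have hS : S ⊆ s.finsupp t := fun ν hν =>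
    Finset.mem_finsupp_iff.2 ⟨Finset.subset_biUnion_of_mem Finsupp.support hν,
      fun j _ => Finset.mem_image_of_mem (fun μ : ι →₀ ℕ => μ j) hν⟩
  calc ∑ ν ∈ S, (ν.prod fun j k => x j ^ k)
      ≤ ∑ ν ∈ s.finsupp t, (ν.prod fun j k => x j ^ k) :=
        Finset.sum_le_sum_of_subset_of_nonneg hS fun ν _ _ => hnonneg ν
    _ = ∏ j ∈ s, ∑ k ∈ t j, x j ^ k := Finset.sum_finsupp_prod_pow s t x
    _ ≤ ∏ j ∈ s, Real.exp (x j / (1 - x j)) := by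
        refine Finset.prod_le_prod
          (fun j _ => Finset.sum_nonneg fun k _ => pow_nonneg (hx0 j) k) fun j _ => ?_
        calc ∑ k ∈ t j, x j ^ k ≤ ∑' k, x j ^ k :=
              (summable_geometric_of_lt_one (hx0 j) (hx1 j)).sum_le_tsum _
                fun k _ => pow_nonneg (hx0 j) k
          _ = x j / (1 - x j) + 1 := by
              rw [tsum_geometric_of_lt_one (hx0 j) (hx1 j)]
              have := (hpos j).ne'
              field_simp
              ring
          _ ≤ Real.exp (x j / (1 - x j)) := Real.add_one_le_exp _
    _ = Real.exp (∑ j ∈ s, x j / (1 - x j)) := (Real.exp_sum _ _).symm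
    _ ≤ Real.exp (∑' j, x j / (1 - x j)) :=
        Real.exp_le_exp.2 <| hquot.sum_le_tsum _ fun j _ => div_nonneg (hx0 j) (hpos j).le

theorem stmt16 (t : ℝ) (ht : 0 < t) (ρ : ℕ → ℝ) (hρ : ∀ j, 1 < ρ j)
  (hsum : Summable fun j => (ρ j)⁻¹ ^ t)
  (a : (ℕ →₀ ℕ) → ℝ) (ha : ∀ ν, 0 ≤ a ν)
  (hsq : Summable fun ν : ℕ →₀ ℕ => ((ν.prod fun j k => ρ j ^ k) * a ν) ^ 2) :
  Summable (fun ν : ℕ →₀ ℕ => a ν ^ (2 * t / (2 + t))) ∧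
  ∑' ν : ℕ →₀ ℕ, a ν ^ (2 * t / (2 + t)) ≤
    (∑' ν : ℕ →₀ ℕ, ((ν.prod fun j k => ρ j ^ k) * a ν) ^ 2) ^ ((2 * t / (2 + t)) / 2) *
      (∑' ν : ℕ →₀ ℕ, ν.prod fun j k => ρ j ^ (-(t * (k : ℝ)))) ^
        ((2 - 2 * t / (2 + t)) / 2) := by
  have hρ0 : ∀ j, 0 < ρ j := fun j => one_pos.trans (hρ j)
  have hpos : ∀ ν : ℕ →₀ ℕ, 0 < ν.prod fun j k => ρ j ^ k :=
    fun ν => Finset.prod_pos fun j _ => pow_pos (hρ0 j) _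
  have hweight : ∀ ν : ℕ →₀ ℕ, (ν.prod fun j k => ρ j ^ (-(t * (k : ℝ)))) =
      (ν.prod fun j k => ρ j ^ k)⁻¹ ^ t := by
    intro ν
    simp only [Finsupp.prod]
    rw [← Finset.prod_inv_distrib,
      ← Real.finsetProd_rpow _ _ fun j _ => inv_nonneg.2 (pow_nonneg (hρ0 j).le _)]
    refine Finset.prod_congr rfl fun j _ => ?_
    rw [Real.inv_rpow (pow_nonneg (hρ0 j).le _), ← Real.rpow_natCast,
      ← Real.rpow_mul (hρ0 j).le, Real.rpow_neg (hρ0 j).le, mul_comm]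
  have hwsum : Summable fun ν : ℕ →₀ ℕ => (ν.prod fun j k => ρ j ^ k)⁻¹ ^ t := by
    have h := Finsupp.summable_prod_pow
      (fun j => Real.rpow_nonneg (inv_nonneg.2 (hρ0 j).le) t)
      (fun j => Real.rpow_lt_one (inv_nonneg.2 (hρ0 j).le) (inv_lt_one_of_one_lt₀ (hρ j)) ht)
      hsum
    refine h.congr fun ν => ?_
    rw [← hweight]
    refine Finset.prod_congr rfl fun j _ => ?_
    beta_reduce
    rw [Real.inv_rpow (hρ0 j).le, ← Real.rpow_neg (hρ0 j).le, ← Real.rpow_mul_natCast (hρ0 j).le,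
      neg_mul]
  have htriple : Real.HolderTriple 2 t (2 * t / (2 + t)) :=
    ⟨by field_simp; ring, two_pos, ht⟩
  have hexp : (2 - 2 * t / (2 + t)) / 2 = 2 * t / (2 + t) / t := by
    field_simp
    ring
  have hmul : ∀ ν : ℕ →₀ ℕ, ((ν.prod fun j k => ρ j ^ k) * a ν) *
      (ν.prod fun j k => ρ j ^ k)⁻¹ = a ν := fun ν => by
    rw [mul_right_comm, mul_inv_cancel₀ (hpos ν).ne', one_mul]
  have key := Real.summable_and_Lr_rpow_le_Lp_mul_Lq_tsum_of_nonneg htriple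
    (fun ν => mul_nonneg (hpos ν).le (ha ν)) (fun ν => inv_nonneg.2 (hpos ν).le)
    (by simpa only [Real.rpow_two] using hsq) hwsum
  simpa only [hmul, hweight, hexp, Real.rpow_two] using key
end

section
/- Let t ∈ (0,∞) and let ρ = (ρ_j)_{j≥1} satisfy ρ_j > 1 for all j and ∑_{j≥1} ρ_j^{−t} < ∞. Define θ_ν := ρ^{−ν} ∏_{j≥1} (1 + ν_j) for ν ∈ ℱ and its monotone envelope θ*_ν := sup_{μ ∈ ℱ, ν ≼ μ} θ_μ. Then ∑_{ν∈ℱ} (θ*_ν)^t < ∞. -/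
open MeasureTheory Filter Topology

/-- A multivariate geometric series over finitely supported exponents converges as soon as its
ratios lie in `[0, 1)` and are summable. -/
theorem summable_finsupp_prod_pow {ι : Type*} {w : ι → ℝ} (h0 : ∀ j, 0 ≤ w j)
    (h1 : ∀ j, w j < 1) (hw : Summable w) :
    Summable fun ν : ι →₀ ℕ => ν.prod fun j k => w j ^ k := by
  classical
  have hb0 : ∀ j, 0 ≤ w j / (1 - w j) := fun j => div_nonneg (h0 j) (by linarith [h1 j])
  have hb : Summable fun j => w j / (1 - w j) := by
    refine (hw.mul_left 2).of_norm_bounded_eventually ?_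
    filter_upwards [hw.tendsto_cofinite_zero.eventually_le_const (show (0 : ℝ) < 1 / 2 by norm_num)]
      with j hj
    rw [Real.norm_of_nonneg (hb0 j), div_le_iff₀ (by linarith [h1 j])]
    nlinarith [h0 j]
  have hgeom : ∀ j n, ∑ k ∈ Finset.range n, w j ^ k ≤ 1 + w j / (1 - w j) := by
    intro j n
    have h : 1 - w j ≠ 0 := by linarith [h1 j]
    calc ∑ k ∈ Finset.range n, w j ^ k ≤ ∑' k, w j ^ k :=
          (summable_geometric_of_lt_one (h0 j) (h1 j)).sum_le_tsum _ fun k _ => pow_nonneg (h0 j) k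
      _ = 1 + w j / (1 - w j) := by
          rw [tsum_geometric_of_lt_one (h0 j) (h1 j)]; field_simp; ring
  have hnonneg : ∀ ν : ι →₀ ℕ, 0 ≤ ν.prod fun j k => w j ^ k := fun ν =>
    Finset.prod_nonneg fun j _ => pow_nonneg (h0 j) _
  refine summable_of_sum_le (c := Real.exp (∑' j, w j / (1 - w j))) hnonneg fun s => ?_
  set F : Finset ι := s.biUnion Finsupp.support
  set N : ℕ := s.sup (fun ν => ν.support.sup ν) + 1
  have hsF : ∀ ν ∈ s, ν.support ⊆ F := fun ν hν => Finset.subset_biUnion_of_mem _ hν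
  have hsN : ∀ ν ∈ s, ∀ j, ν j < N := by
    intro ν hν j
    by_cases hj : j ∈ ν.support
    · exact Nat.lt_succ_of_le ((Finset.le_sup (f := ν) hj).trans
        (Finset.le_sup (f := fun ν : ι →₀ ℕ => ν.support.sup ν) hν))
    · simp [Finsupp.notMem_support_iff.1 hj, N]
  calc ∑ ν ∈ s, ν.prod (fun j k => w j ^ k)
      = ∑ ν ∈ s, ∏ j : F, w j ^ ν j := by
        refine Finset.sum_congr rfl fun ν hν => ?_
        rw [Finsupp.prod_of_support_subset ν (hsF ν hν) _ (by simp)]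
        exact (Finset.prod_coe_sort F fun j => w j ^ ν j).symm
    _ = ∑ p ∈ s.image (fun ν (j : F) => ν j), ∏ j : F, w j ^ p j := by
        rw [Finset.sum_image]
        intro ν hν μ hμ h
        ext j
        by_cases hj : j ∈ F
        · exact congrFun h ⟨j, hj⟩
        · rw [Finsupp.notMem_support_iff.1 fun h => hj (hsF ν hν h),
            Finsupp.notMem_support_iff.1 fun h => hj (hsF μ hμ h)]
    _ ≤ ∑ p ∈ Fintype.piFinset fun _ : F => Finset.range N, ∏ j : F, w j ^ p j := by
        refine Finset.sum_le_sum_of_subset_of_nonneg ?_ fun p _ _ =>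
          Finset.prod_nonneg fun j _ => pow_nonneg (h0 j) _
        intro p hp
        obtain ⟨ν, hν, rfl⟩ := Finset.mem_image.1 hp
        simpa using fun j _ => hsN ν hν j
    _ = ∏ j : F, ∑ k ∈ Finset.range N, w j ^ k := (Finset.prod_univ_sum _ _).symm
    _ ≤ ∏ j : F, (1 + w j / (1 - w j)) :=
        Finset.prod_le_prod (fun j _ => Finset.sum_nonneg fun k _ => pow_nonneg (h0 j) k)
          fun j _ => hgeom j N
    _ = ∏ j ∈ F, (1 + w j / (1 - w j)) := Finset.prod_coe_sort F fun j => 1 + w j / (1 - w j)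
    _ ≤ Real.exp (∑ j ∈ F, w j / (1 - w j)) := Real.prod_one_add_le_exp_sum _ fun j => hb0 j
    _ ≤ Real.exp (∑' j, w j / (1 - w j)) :=
        Real.exp_le_exp.2 (hb.sum_le_tsum _ fun j _ => hb0 j)

/-- The sequence `x ^ k * (1 + k)` is dominated by a geometric one, with constant `1` and ratio
`2 * x` when `x` is small. -/
theorem exists_geometric_bound {x : ℝ} (h0 : 0 < x) (h1 : x < 1) :
    ∃ c z : ℝ, 1 ≤ c ∧ 0 < z ∧ z < 1 ∧ (∀ k : ℕ, x ^ k * (1 + (k : ℝ)) ≤ c * z ^ k) ∧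
      (x ≤ 1 / 4 → c = 1 ∧ z = 2 * x) := by
  by_cases hx : x ≤ 1 / 4
  · refine ⟨1, 2 * x, le_rfl, by linarith, by linarith, fun k => ?_, fun _ => ⟨rfl, rfl⟩⟩
    have h : 1 + (k : ℝ) ≤ 2 ^ k := by
      have := one_add_mul_le_pow (show (-2 : ℝ) ≤ 1 by norm_num) k
      norm_num at this
      exact this
    rw [one_mul, mul_pow, mul_comm]
    gcongr
  · have hs0 : 0 < √x := Real.sqrt_pos.2 h0
    have hs1 : √x < 1 := by rw [Real.sqrt_lt' one_pos]; simpa using h1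
    have hlim : Tendsto (fun k : ℕ => √x ^ k * (1 + (k : ℝ))) atTop (𝓝 0) := by
      have := (tendsto_pow_atTop_nhds_zero_of_lt_one hs0.le hs1).add
        (tendsto_self_mul_const_pow_of_lt_one hs0.le hs1)
      rw [add_zero] at this
      exact this.congr fun k => by ring
    obtain ⟨C, hC⟩ := hlim.bddAbove_range
    refine ⟨max 1 C, √x, le_max_left _ _, hs0, hs1, fun k => ?_, fun h => absurd h hx⟩
    calc x ^ k * (1 + (k : ℝ)) = (√x ^ k * (1 + (k : ℝ))) * √x ^ k := by
          nth_rewrite 1 [← Real.mul_self_sqrt h0.le]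
          rw [mul_pow]; ring
      _ ≤ max 1 C * √x ^ k := by
          gcongr
          exact (hC ⟨k, rfl⟩).trans (le_max_right _ _)

theorem stmt17 (t : ℝ) (ht : 0 < t) (ρ : ℕ → ℝ) (hρ : ∀ j, 1 < ρ j)
  (hsum : Summable fun j => (ρ j)⁻¹ ^ t) :
  Summable fun ν : ℕ →₀ ℕ =>
    (⨆ σ : {σ : ℕ →₀ ℕ // ν ≤ σ},
      σ.1.prod fun j k => (ρ j)⁻¹ ^ k * (1 + (k : ℝ))) ^ t := by
  have hx0 : ∀ j, 0 < (ρ j)⁻¹ := fun j => inv_pos.2 (one_pos.trans (hρ j))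
  choose c z hc hz0 hz1 hcz hsmall using fun j =>
    exists_geometric_bound (hx0 j) (inv_lt_one_of_one_lt₀ (hρ j))
  have hev : ∀ᶠ j in cofinite, (ρ j)⁻¹ ≤ 1 / 4 := by
    filter_upwards [hsum.tendsto_cofinite_zero.eventually_le_const
      (show (0 : ℝ) < (1 / 4) ^ t by positivity)] with j hj
    exact (Real.rpow_le_rpow_iff (hx0 j).le (by norm_num) ht).1 hj
  have hw : Summable fun j => z j ^ t := by
    refine (hsum.mul_left (2 ^ t)).of_norm_bounded_eventually ?_
    filter_upwards [hev] with j hj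
    rw [Real.norm_of_nonneg (Real.rpow_nonneg (hz0 j).le t), (hsmall j hj).2,
      Real.mul_rpow zero_le_two (hx0 j).le]
  have hgeom := summable_finsupp_prod_pow (fun j => Real.rpow_nonneg (hz0 j).le t)
    (fun j => Real.rpow_lt_one (hz0 j).le (hz1 j) ht) hw
  set B : Finset ℕ := (eventually_cofinite.1 hev).toFinset
  have hcB : ∀ j ∉ B, c j = 1 := fun j hj => (hsmall j (by simpa [B] using hj)).1
  have hK : 0 ≤ ∏ j ∈ B, c j := Finset.prod_nonneg fun j _ => zero_le_one.trans (hc j)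
  have hθ : ∀ σ : ℕ →₀ ℕ, 0 ≤ σ.prod fun j k => (ρ j)⁻¹ ^ k * (1 + (k : ℝ)) := fun σ =>
    Finset.prod_nonneg fun j _ => mul_nonneg (pow_nonneg (hx0 j).le _) (by positivity)
  have hprod : ∀ ν : ℕ →₀ ℕ, 0 ≤ ν.prod fun j k => z j ^ k := fun ν =>
    Finset.prod_nonneg fun j _ => pow_nonneg (hz0 j).le _
  have hbound : ∀ ν σ : ℕ →₀ ℕ, ν ≤ σ →
      (σ.prod fun j k => (ρ j)⁻¹ ^ k * (1 + (k : ℝ))) ≤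
        (∏ j ∈ B, c j) * ν.prod fun j k => z j ^ k := by
    intro ν σ h
    rw [Finsupp.prod_of_support_subset σ (Finset.subset_union_left (s₂ := B)) _ (by simp),
      Finsupp.prod_of_support_subset ν
        ((Finsupp.support_mono h).trans (Finset.subset_union_left (s₂ := B))) _ (by simp),
      Finset.prod_subset (Finset.subset_union_right (s₁ := σ.support)) fun j _ hj => hcB j hj,
      ← Finset.prod_mul_distrib]
    refine Finset.prod_le_prod
      (fun j _ => mul_nonneg (pow_nonneg (hx0 j).le _) (by positivity)) fun j _ => ?_
    exact (hcz j _).trans (mul_le_mul_of_nonneg_left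
      (pow_le_pow_of_le_one (hz0 j).le (hz1 j).le (h j)) (zero_le_one.trans (hc j)))
  have hsup : ∀ ν : ℕ →₀ ℕ, 0 ≤ ⨆ σ : {σ : ℕ →₀ ℕ // ν ≤ σ},
      σ.1.prod fun j k => (ρ j)⁻¹ ^ k * (1 + (k : ℝ)) := fun ν => by
    apply Real.iSup_nonneg
    exact fun σ => hθ σ.1
  refine Summable.of_nonneg_of_le (fun ν => Real.rpow_nonneg (hsup ν) t) (fun ν => ?_)
    (hgeom.mul_left ((∏ j ∈ B, c j) ^ t))
  have hle : (⨆ σ : {σ : ℕ →₀ ℕ // ν ≤ σ},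
      σ.1.prod fun j k => (ρ j)⁻¹ ^ k * (1 + (k : ℝ))) ≤
        (∏ j ∈ B, c j) * ν.prod fun j k => z j ^ k := by
    apply Real.iSup_le
    · exact fun σ => hbound ν σ.1 σ.2
    · exact mul_nonneg hK (hprod ν)
  refine (Real.rpow_le_rpow (hsup ν) hle ht.le).trans_eq ?_
  rw [Real.mul_rpow hK (hprod ν), Finsupp.prod, Finsupp.prod,
    ← Real.finsetProd_rpow _ _ fun j _ => pow_nonneg (hz0 j).le _]
  congr 1
  exact Finset.prod_congr rfl fun j _ => (Real.rpow_pow_comm (hz0 j).le t _).symm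
end
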